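/- arXiv:1510.01086 — 2 statements merged into one kernel-verified Lean document; each statement's English description precedes it below -/
import Mathlib

section
/- For every topological space X and every function f : X → ℝ, f is a first Baire class function if and only if f is a first functional Lebesgue class function; that is, B₁(X, ℝ) = H₁*(X, ℝ). -/
open Set Filter Topology TopologicalSpace

/-- A subset `A` of a topological space is functionally closed if it is the
zero set of a continuous real-valued function. -/
def FunctionallyClosed {X : Type*} [TopologicalSpace X] (A : Set X) : Prop :=
  ∃ g : X → ℝ, Continuous g ∧ A = g ⁻¹' {0}

/-- `A` is a countable union of functionally closed subsets. -/
def CountableUnionOfFunctionallyClosed {X : Type*} [TopologicalSpace X] (A : Set X) : Prop :=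
  ∃ F : ℕ → Set X, (∀ n, FunctionallyClosed (F n)) ∧ A = ⋃ n, F n

/-- `f : X → ℝ` is a first Baire class function: a pointwise limit of a
sequence of continuous functions. -/
def BaireOne {X : Type*} [TopologicalSpace X] (f : X → ℝ) : Prop :=
  ∃ g : ℕ → X → ℝ, (∀ n, Continuous (g n)) ∧
    ∀ x, Tendsto (fun n => g n x) atTop (𝓝 (f x))

/-- A countable intersection of functionally closed sets is functionally closed. -/
theorem FunctionallyClosed.iInter {X : Type*} [TopologicalSpace X] {F : ℕ → Set X}
    (hF : ∀ n, FunctionallyClosed (F n)) : FunctionallyClosed (⋂ n, F n) := by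
  choose g hg hFg using hF
  have bound : ∀ n x, ‖(1 / 2 : ℝ) ^ n * min 1 |g n x|‖ ≤ (1 / 2 : ℝ) ^ n := by
    intro n x
    have hmin : 0 ≤ min 1 |g n x| := le_min zero_le_one (abs_nonneg _)
    rw [Real.norm_of_nonneg (by positivity)]
    exact mul_le_of_le_one_right (by positivity) (min_le_left _ _)
  refine ⟨fun x => ∑' n, (1 / 2 : ℝ) ^ n * min 1 |g n x|,
    continuous_tsum (fun n => by have := hg n; fun_prop) summable_geometric_two bound, ?_⟩
  ext x
  have hsum : Summable fun n => (1 / 2 : ℝ) ^ n * min 1 |g n x| :=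
    Summable.of_norm_bounded summable_geometric_two fun n => bound n x
  have hnonneg : ∀ n, 0 ≤ (1 / 2 : ℝ) ^ n * min 1 |g n x| := fun n =>
    mul_nonneg (by positivity) (le_min zero_le_one (abs_nonneg _))
  simp only [mem_iInter, hFg, mem_preimage, mem_singleton_iff]
  constructor
  · intro h
    simp [h]
  · intro h n
    have hn := congrFun ((hsum.hasSum_iff.2 h |> (hasSum_zero_iff_of_nonneg hnonneg).1)) n
    have hmin : min 1 |g n x| = 0 := by simpa using hn
    rcases min_choice 1 |g n x| with h1 | h1 <;> rw [h1] at hmin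
    · exact absurd hmin one_ne_zero
    · exact abs_eq_zero.1 hmin

/-- Superlevel sets of continuous functions are functionally closed. -/
theorem Continuous.functionallyClosed_le {X : Type*} [TopologicalSpace X] {g : X → ℝ}
    (hg : Continuous g) (c : ℝ) : FunctionallyClosed {x | c ≤ g x} :=
  ⟨fun x => max 0 (c - g x), by fun_prop, by ext x; simp⟩

/-- Every open set of reals is the positivity set of a continuous function. -/
theorem IsOpen.exists_continuous_pos_iff_mem {G : Set ℝ} (hG : IsOpen G) :
    ∃ h : ℝ → ℝ, Continuous h ∧ ∀ y, 0 < h y ↔ y ∈ G := by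
  rcases Gᶜ.eq_empty_or_nonempty with hc | hc
  · refine ⟨fun _ => 1, continuous_const, fun y => ?_⟩
    simp [compl_empty_iff.1 hc]
  · refine ⟨fun y => Metric.infDist y Gᶜ, Metric.continuous_infDist_pt _, fun y => ?_⟩
    rw [← hG.isClosed_compl.notMem_iff_infDist_pos hc, notMem_compl_iff]

/-- The preimage of an open set under a first Baire class function is a countable union of
functionally closed sets. -/
theorem BaireOne.preimage_isOpen {X : Type*} [TopologicalSpace X] {f : X → ℝ} (hf : BaireOne f)
    {G : Set ℝ} (hG : IsOpen G) : CountableUnionOfFunctionallyClosed (f ⁻¹' G) := by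
  obtain ⟨g, hg, hlim⟩ := hf
  obtain ⟨h, hh, hpos⟩ := hG.exists_continuous_pos_iff_mem
  refine ⟨fun k => ⋂ n, {x | 1 / ((k : ℝ) + 1) ≤ h (g (n + k) x)},
    fun k => .iInter fun n => (hh.comp (hg _)).functionallyClosed_le _, ?_⟩
  ext x
  have hx : Tendsto (fun n => h (g n x)) atTop (𝓝 (h (f x))) := (hh.tendsto _).comp (hlim x)
  simp only [mem_preimage, mem_iUnion, mem_iInter, mem_ofPred_eq, ← hpos]
  constructor
  · intro hfx
    obtain ⟨N, hN⟩ := eventually_atTop.1 (hx.eventually (lt_mem_nhds (half_lt_self hfx)))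
    obtain ⟨m, hm⟩ := exists_nat_one_div_lt (half_pos hfx)
    refine ⟨max N m, fun n => ?_⟩
    have hle : 1 / (((max N m : ℕ) : ℝ) + 1) ≤ 1 / ((m : ℝ) + 1) :=
      Nat.one_div_le_one_div (le_max_right N m)
    exact hle.trans (hm.trans (hN _ (by omega))).le
  · rintro ⟨k, hk⟩
    have hle := ge_of_tendsto' ((tendsto_add_atTop_iff_nat k).2 hx) hk
    exact lt_of_lt_of_le (by positivity) hle

/-- Given a countable cover by functionally closed sets, the function taking the value `c i` at the
points whose first covering set is the `i`-th one is of the first Baire class. -/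
theorem baireOne_find_of_cover {X : Type*} [TopologicalSpace X] {F : ℕ → Set X}
    [∀ x, DecidablePred fun i => x ∈ F i]
    (hF : ∀ i, FunctionallyClosed (F i)) (hcover : ∀ x, ∃ i, x ∈ F i) (c : ℕ → ℝ) :
    BaireOne fun x => c (Nat.find (hcover x)) := by
  choose d hd hFd using hF
  let t : ℕ → ℕ → X → ℝ := fun n i x => max 0 (1 - n * |d i x|)
  have ht : ∀ n i, Continuous (t n i) := fun n i => by have := hd i; fun_prop
  refine ⟨fun n x => ∑ i ∈ Finset.range n, c i * (t n i x * ∏ j ∈ Finset.range i, (1 - t n j x)),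
    fun n => by fun_prop, fun x => ?_⟩
  beta_reduce
  set i₀ := Nat.find (hcover x)
  have hone : ∀ n, t n i₀ x = 1 := by
    intro n
    have hmem : x ∈ F i₀ := Nat.find_spec (hcover x)
    have hzero : d i₀ x = 0 := by simpa [hFd i₀] using hmem
    simp [t, hzero]
  have hzero : ∀ᶠ n in atTop, ∀ j ∈ Finset.range i₀, t n j x = 0 := by
    rw [Filter.eventually_all_finset]
    intro j hj
    have hmem : x ∉ F j := Nat.find_min (hcover x) (Finset.mem_range.1 hj)
    have hpos : 0 < |d j x| := abs_pos.2 (by simpa [hFd j] using hmem)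
    filter_upwards [(tendsto_natCast_atTop_atTop.atTop_mul_const hpos).eventually_ge_atTop
      (1 : ℝ)] with n hn
    exact max_eq_left (by linarith)
  refine tendsto_const_nhds.congr' ?_
  filter_upwards [hzero, eventually_gt_atTop i₀] with n hn hlt
  symm
  rw [Finset.sum_eq_single_of_mem i₀ (Finset.mem_range.2 hlt)]
  · rw [hone, Finset.prod_eq_one fun j hj => by rw [hn j hj, sub_zero]]
    simp
  · intro i _ hi
    rcases lt_or_gt_of_ne hi with h | h
    · simp [hn i (Finset.mem_range.2 h)]
    · rw [Finset.prod_eq_zero (Finset.mem_range.2 h) (by rw [hone, sub_self])]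
      simp

/-- A first functional Lebesgue class function is uniformly approximated by first Baire class
functions. -/
theorem exists_baireOne_dist_lt {X : Type*} [TopologicalSpace X] {f : X → ℝ}
    (hf : ∀ G : Set ℝ, IsOpen G → CountableUnionOfFunctionallyClosed (f ⁻¹' G))
    {ε : ℝ} (hε : 0 < ε) : ∃ g, BaireOne g ∧ ∀ x, dist (f x) (g x) < ε := by
  classical
  choose F hF hFf using fun k => hf (Metric.ball (denseSeq ℝ k) ε) Metric.isOpen_ball
  have hcover : ∀ x, ∃ i : ℕ, x ∈ F i.unpair.1 i.unpair.2 := by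
    intro x
    obtain ⟨k, hk⟩ := (denseRange_denseSeq ℝ).exists_dist_lt (f x) hε
    have hx : x ∈ ⋃ n, F k n := hFf k ▸ hk
    obtain ⟨n, hn⟩ := mem_iUnion.1 hx
    exact ⟨Nat.pair k n, by simpa using hn⟩
  refine ⟨_, baireOne_find_of_cover (fun i => hF i.unpair.1 i.unpair.2) hcover
    (fun i => denseSeq ℝ i.unpair.1), fun x => ?_⟩
  have hx : x ∈ f ⁻¹' Metric.ball _ ε :=
    (hFf _).symm ▸ mem_iUnion.2 ⟨_, Nat.find_spec (hcover x)⟩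
  exact hx

/-- A uniform limit of first Baire class functions is of the first Baire class. -/
theorem baireOne_of_forall_exists_dist_lt {X : Type*} [TopologicalSpace X] {f : X → ℝ}
    (hf : ∀ ε > 0, ∃ g, BaireOne g ∧ ∀ x, dist (f x) (g x) < ε) : BaireOne f := by
  choose g hg hfg using fun k : ℕ => hf ((1 / 2 : ℝ) ^ k) (by positivity)
  choose a ha hlim using hg
  let b : ℕ → ℝ := fun k => 2 * (1 / 2 : ℝ) ^ k
  have hb : Summable b := summable_geometric_two.mul_left 2
  have hbpos : ∀ k, 0 < b k := fun k => by positivity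
  let clamp : ℕ → ℝ → ℝ := fun k y => max (-b k) (min (b k) y)
  have hclamp : ∀ k, Continuous (clamp k) := fun k => by fun_prop
  have hbound : ∀ k y, ‖clamp k y‖ ≤ b k := fun k y => abs_le.2
    ⟨le_max_left _ _, max_le (by linarith [hbpos k]) (min_le_left _ _)⟩
  have hgf : ∀ x, Tendsto (fun k => g k x) atTop (𝓝 (f x)) := by
    intro x
    refine tendsto_iff_dist_tendsto_zero.2 (squeeze_zero (fun _ => dist_nonneg)
      (fun k => by rw [dist_comm]; exact (hfg k x).le)
      (tendsto_pow_atTop_nhds_zero_of_lt_one (by norm_num) (by norm_num)))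
  have hclamp_eq : ∀ k x, clamp k (g (k + 1) x - g k x) = g (k + 1) x - g k x := by
    intro k x
    have h1 := abs_lt.1 (hfg k x)
    have h2 := abs_lt.1 (hfg (k + 1) x)
    have h3 : (1 / 2 : ℝ) ^ (k + 1) ≤ (1 / 2 : ℝ) ^ k :=
      pow_le_pow_of_le_one (by norm_num) (by norm_num) k.le_succ
    have h4 : b k = 2 * (1 / 2 : ℝ) ^ k := rfl
    simp only [clamp]
    rw [min_eq_right (by linarith), max_eq_right (by linarith)]
  have htsum : ∀ x, ∑' k, clamp k (g (k + 1) x - g k x) = f x - g 0 x := by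
    intro x
    have hsum : Summable fun k => clamp k (g (k + 1) x - g k x) :=
      Summable.of_norm_bounded hb fun k => hbound k _
    refine tendsto_nhds_unique hsum.hasSum.tendsto_sum_nat ?_
    simp only [hclamp_eq, Finset.sum_range_sub (fun k => g k x)]
    exact (hgf x).sub_const _
  refine ⟨fun n x => a 0 n x + ∑' k, clamp k (a (k + 1) n x - a k n x), fun n => ?_, fun x => ?_⟩
  · exact (ha 0 n).add (continuous_tsum
      (fun k => (hclamp k).comp ((ha (k + 1) n).sub (ha k n))) hb fun k x => hbound k _)
  · have h := tendsto_tsum_of_dominated_convergence (𝓕 := atTop)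
      (f := fun n k => clamp k (a (k + 1) n x - a k n x)) hb
      (fun k => ((hclamp k).tendsto _).comp ((hlim (k + 1) x).sub (hlim k x)))
      (Eventually.of_forall fun n k => hbound k _)
    rw [htsum] at h
    simpa using (hlim 0 x).add h

theorem baire_one_iff_first_functional_lebesgue
    {X : Type*} [TopologicalSpace X] (f : X → ℝ) :
    BaireOne f ↔
      ∀ G : Set ℝ, IsOpen G → CountableUnionOfFunctionallyClosed (f ⁻¹' G) :=
  ⟨fun hf _ hG => hf.preimage_isOpen hG,
    fun hf => baireOne_of_forall_exists_dist_lt fun _ hε => exists_baireOne_dist_lt hf hε⟩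
end

section
/- Let X be a topological space. For every function f : X → ℝ the following conditions are equivalent: (i) f is a first Baire class function; (ii) for each pair of real numbers a < b there exist sets H₁ and H₂, each a countable union of functionally closed subsets of X, such that f⁻¹((a, +∞)) ⊇ H₁ ⊇ f⁻¹((b, +∞)) and f⁻¹((-∞, b)) ⊇ H₂ ⊇ f⁻¹((-∞, a)). -/
open Set Filter Topology TopologicalSpace

section

variable {X : Type*} [TopologicalSpace X]

/-- Countable intersections of zero sets are zero sets, via metrizability of `ℕ → ℝ`. -/
lemma functionallyClosed_iInter {F : ℕ → Set X} (hF : ∀ n, FunctionallyClosed (F n)) :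
    FunctionallyClosed (⋂ n, F n) := by
  choose g hg hFg using hF
  let _ : MetricSpace (ℕ → ℝ) := metrizableSpaceMetric (ℕ → ℝ)
  refine ⟨fun x => dist (fun n => g n x) (fun _ => 0),
    (continuous_pi hg).dist continuous_const, ?_⟩
  ext x
  simp [hFg, dist_eq_zero, funext_iff]

lemma functionallyClosed_biUnion_finset {ι : Type*} {F : ι → Set X}
    (hF : ∀ i, FunctionallyClosed (F i)) (s : Finset ι) :
    FunctionallyClosed (⋃ i ∈ s, F i) := by
  choose g hg hFg using hF
  refine ⟨fun x => ∏ i ∈ s, g i x, continuous_finsetProd s fun i _ => hg i, ?_⟩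
  ext x
  simp [hFg, Finset.prod_eq_zero_iff]

lemma functionallyClosed_le {u v : X → ℝ} (hu : Continuous u) (hv : Continuous v) :
    FunctionallyClosed {x | u x ≤ v x} := by
  refine ⟨fun x => max (u x - v x) 0, (hu.sub hv).max continuous_const, ?_⟩
  ext x
  simp

/-- A countable union of zero sets is the union of an increasing sequence of zero sets. -/
lemma CountableUnionOfFunctionallyClosed.exists_monotone {H : Set X}
    (hH : CountableUnionOfFunctionallyClosed H) :
    ∃ F : ℕ → Set X, Monotone F ∧ (∀ n, FunctionallyClosed (F n)) ∧ H = ⋃ n, F n := by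
  obtain ⟨F, hF, rfl⟩ := hH
  refine ⟨fun n => ⋃ i ∈ Finset.range (n + 1), F i, ?_,
    fun n => functionallyClosed_biUnion_finset hF _, ?_⟩
  · intro m n hmn
    exact biUnion_subset_biUnion_left fun i hi => by
      simp only [Finset.coe_range, mem_Iio] at hi ⊢
      omega
  · ext x
    simp only [mem_iUnion, Finset.mem_range, exists_prop]
    exact ⟨fun ⟨i, hi⟩ => ⟨i, i, by omega, hi⟩, fun ⟨_, i, _, hi⟩ => ⟨i, hi⟩⟩

lemma BaireOne.neg {f : X → ℝ} (hf : BaireOne f) : BaireOne (fun x => -f x) := by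
  obtain ⟨g, hg, hgf⟩ := hf
  exact ⟨fun n x => -g n x, fun n => (hg n).neg, fun x => (hgf x).neg⟩

lemma BaireOne.exists_between_Ioi {f : X → ℝ} (hf : BaireOne f) {a b : ℝ} (hab : a < b) :
    ∃ H : Set X, CountableUnionOfFunctionallyClosed H ∧
      f ⁻¹' Ioi b ⊆ H ∧ H ⊆ f ⁻¹' Ioi a := by
  obtain ⟨g, hg, hgf⟩ := hf
  refine ⟨⋃ N, ⋂ n, {x | b ≤ g (N + n) x}, ⟨_, fun N => functionallyClosed_iInter
    fun n => functionallyClosed_le continuous_const (hg _), rfl⟩, ?_, ?_⟩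
  · intro x hx
    obtain ⟨N, hN⟩ := eventually_atTop.1 ((hgf x).eventually_const_lt hx)
    exact mem_iUnion.2 ⟨N, mem_iInter.2 fun n => (hN _ (Nat.le_add_right N n)).le⟩
  · intro x hx
    obtain ⟨N, hN⟩ := mem_iUnion.1 hx
    refine hab.trans_le (ge_of_tendsto (hgf x) ?_)
    filter_upwards [eventually_ge_atTop N] with n hn
    obtain ⟨k, rfl⟩ := Nat.exists_eq_add_of_le hn
    exact mem_iInter.1 hN k

/-- Two zero sets can be separated by a continuous function taking prescribed bounds on them,
provided they are disjoint whenever the bounds conflict. -/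
lemma exists_continuous_le_and_ge {F G : Set X} (hF : FunctionallyClosed F)
    (hG : FunctionallyClosed G) {a b : ℝ} (h : b ≤ a → Disjoint F G) :
    ∃ u : X → ℝ, Continuous u ∧ (∀ x ∈ F, a ≤ u x) ∧ ∀ x ∈ G, u x ≤ b := by
  rcases lt_or_ge a b with hab | hab
  · exact ⟨fun _ => a, continuous_const, fun _ _ => le_rfl, fun _ _ => hab.le⟩
  obtain ⟨φ, hφ, rfl⟩ := hF
  obtain ⟨γ, hγ, rfl⟩ := hG
  have hne : ∀ x, |φ x| + |γ x| ≠ 0 := fun x hx => by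
    have h0 := (add_eq_zero_iff_of_nonneg (abs_nonneg _) (abs_nonneg _)).1 hx
    exact disjoint_left.1 (h hab) (abs_eq_zero.1 h0.1) (abs_eq_zero.1 h0.2)
  refine ⟨fun x => (b * |φ x| + a * |γ x|) / (|φ x| + |γ x|), by fun_prop (disch := assumption),
    fun x hx => ?_, fun x hx => ?_⟩
  · have hx : φ x = 0 := hx
    have := hne x
    simp only [hx, abs_zero, mul_zero, zero_add] at this ⊢
    rw [mul_div_cancel_right₀ _ this]
  · have hx : γ x = 0 := hx
    have := hne x
    simp only [hx, abs_zero, mul_zero, add_zero] at this ⊢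
    rw [mul_div_cancel_right₀ _ this]

/-- A finite family of lower bounds on zero sets and upper bounds on zero sets is met by a
continuous function, provided the sets are disjoint whenever the bounds conflict. -/
lemma exists_continuous_forall_le_and_ge {ι : Type*} {s : Finset ι} (hs : s.Nonempty)
    {F G : ι → Set X} (hF : ∀ i, FunctionallyClosed (F i)) (hG : ∀ i, FunctionallyClosed (G i))
    {a b : ι → ℝ} (h : ∀ i j, b j ≤ a i → Disjoint (F i) (G j)) :
    ∃ u : X → ℝ, Continuous u ∧
      ∀ i ∈ s, (∀ x ∈ F i, a i ≤ u x) ∧ ∀ x ∈ G i, u x ≤ b i := by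
  choose u hu huF huG using fun i j => exists_continuous_le_and_ge (hF i) (hG j) (h i j)
  refine ⟨fun x => s.sup' hs fun i => s.inf' hs fun j => u i j x,
    Continuous.finset_sup'_apply hs fun i _ => Continuous.finset_inf'_apply hs fun j _ => hu i j,
    fun i hi => ⟨fun x hx => ?_, fun x hx => ?_⟩⟩
  · exact (Finset.le_inf' hs _ fun j _ => huF i j x hx).trans
      (Finset.le_sup' (fun i => s.inf' hs fun j => u i j x) hi)
  · exact Finset.sup'_le hs _ fun k _ =>
      (Finset.inf'_le (fun j => u k j x) hi).trans (huG k i x hx)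

/-- If for all `a < b` the sets `{f > b} ⊆ {f > a}` and `{f < a} ⊆ {f < b}` can be interpolated by
countable unions of zero sets, then `f` is of the first Baire class. -/
lemma baireOne_of_sandwich {f : X → ℝ}
    (h : ∀ a b : ℝ, a < b → ∃ H₁ H₂ : Set X,
      CountableUnionOfFunctionallyClosed H₁ ∧ CountableUnionOfFunctionallyClosed H₂ ∧
      f ⁻¹' Ioi b ⊆ H₁ ∧ H₁ ⊆ f ⁻¹' Ioi a ∧ f ⁻¹' Iio a ⊆ H₂ ∧ H₂ ⊆ f ⁻¹' Iio b) :
    BaireOne f := by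
  have : Nonempty {p : ℚ × ℚ // p.1 < p.2} := ⟨⟨(0, 1), zero_lt_one⟩⟩
  obtain ⟨e, he⟩ := exists_surjective_nat {p : ℚ × ℚ // p.1 < p.2}
  choose H₁ H₂ hH₁ hH₂ hbH₁ hH₁a haH₂ hH₂b using
    fun i => h (e i).1.1 (e i).1.2 (Rat.cast_lt.2 (e i).2)
  choose F hFmono hF hFH using fun i => (hH₁ i).exists_monotone
  choose G hGmono hG hGH using fun i => (hH₂ i).exists_monotone
  have hdisj : ∀ n i j, ((e j).1.2 : ℝ) ≤ (e i).1.1 → Disjoint (F i n) (G j n) := by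
    intro n i j hij
    refine disjoint_left.2 fun x hxF hxG => ?_
    have h₁ : ((e i).1.1 : ℝ) < f x := hH₁a i (hFH i ▸ mem_iUnion.2 ⟨n, hxF⟩)
    have h₂ : f x < (e j).1.2 := hH₂b j (hGH j ▸ mem_iUnion.2 ⟨n, hxG⟩)
    linarith
  choose g hg hgFG using fun n => exists_continuous_forall_le_and_ge
    (s := Finset.range (n + 1)) Finset.nonempty_range_add_one
    (fun i => hF i n) (fun i => hG i n) (hdisj n)
  refine ⟨g, hg, fun x => tendsto_order.2 ⟨fun c hc => ?_, fun c hc => ?_⟩⟩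
  · obtain ⟨q, hcq, hqf⟩ := exists_rat_btwn hc
    obtain ⟨p, hcp, hpq⟩ := exists_rat_btwn hcq
    obtain ⟨i, hi⟩ := he ⟨(p, q), Rat.cast_lt.1 hpq⟩
    have hx : x ∈ H₁ i := hbH₁ i (by simpa [hi] using hqf)
    rw [hFH i] at hx
    obtain ⟨m, hm⟩ := mem_iUnion.1 hx
    filter_upwards [eventually_ge_atTop m, eventually_ge_atTop i] with n hmn hin
    have := (hgFG n i (Finset.mem_range.2 (by omega))).1 x (hFmono i hmn hm)
    rw [hi] at this
    exact hcp.trans_le this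
  · obtain ⟨p, hfp, hpc⟩ := exists_rat_btwn hc
    obtain ⟨q, hpq, hqc⟩ := exists_rat_btwn hpc
    obtain ⟨i, hi⟩ := he ⟨(p, q), Rat.cast_lt.1 hpq⟩
    have hx : x ∈ H₂ i := haH₂ i (by simpa [hi] using hfp)
    rw [hGH i] at hx
    obtain ⟨m, hm⟩ := mem_iUnion.1 hx
    filter_upwards [eventually_ge_atTop m, eventually_ge_atTop i] with n hmn hin
    have := (hgFG n i (Finset.mem_range.2 (by omega))).2 x (hGmono i hmn hm)
    rw [hi] at this
    exact this.trans_lt hqc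

end

theorem baire_one_iff_sandwich
    {X : Type*} [TopologicalSpace X] (f : X → ℝ) :
    BaireOne f ↔
      ∀ a b : ℝ, a < b →
        ∃ H₁ H₂ : Set X,
          CountableUnionOfFunctionallyClosed H₁ ∧
          CountableUnionOfFunctionallyClosed H₂ ∧
          f ⁻¹' Ioi b ⊆ H₁ ∧ H₁ ⊆ f ⁻¹' Ioi a ∧
          f ⁻¹' Iio a ⊆ H₂ ∧ H₂ ⊆ f ⁻¹' Iio b := by
  refine ⟨fun hf a b hab => ?_, baireOne_of_sandwich⟩
  obtain ⟨H₁, hH₁, hbH₁, hH₁a⟩ := hf.exists_between_Ioi hab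
  obtain ⟨H₂, hH₂, haH₂, hH₂b⟩ := hf.neg.exists_between_Ioi (neg_lt_neg hab)
  exact ⟨H₁, H₂, hH₁, hH₂, hbH₁, hH₁a, fun x hx => haH₂ (show -a < -f x from neg_lt_neg hx),
    fun x hx => show f x < b from lt_of_neg_lt_neg (hH₂b hx)⟩
end
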